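/- Let P = conv{x₀, x₁, …, xₙ} ⊂ ℝⁿ be an n-simplex, i.e., the convex hull of n + 1 affinely independent points. Then P has minimal depth ⌈log₂(n + 1)⌉; that is, P ∈ Δₙ(⌈log₂(n+1)⌉) and P ∉ Δₙ(⌈log₂(n+1)⌉ − 1). -/

import Mathlib

open Pointwise

noncomputable section

/-- A polytope in `ℝⁿ`: the convex hull of a nonempty finite set of points. -/
def IsPolytope (n : ℕ) (P : Set (Fin n → ℝ)) : Prop :=
  ∃ s : Finset (Fin n → ℝ), s.Nonempty ∧ P = convexHull ℝ ↑s

/-- `PolyDepth n m` is the set `Δₙ(m)` of neural network polytopes with `m` hidden layers: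
`Δₙ(0)` consists of the one-point polytopes, and `Δₙ(m)` consists of the Minkowski sums
`Σᵢ conv(Pᵢ ∪ Qᵢ)` with `Pᵢ, Qᵢ ∈ Δₙ(m-1)`. -/
def PolyDepth (n : ℕ) : ℕ → Set (Set (Fin n → ℝ))
  | 0 => {P | ∃ a, P = {a}}
  | m + 1 => {P | ∃ (k : ℕ) (Q R : Fin (k + 1) → Set (Fin n → ℝ)),
      (∀ i, Q i ∈ PolyDepth n m ∧ R i ∈ PolyDepth n m) ∧
      P = ∑ i, convexHull ℝ (Q i ∪ R i)}

/-- `P` has minimal depth `m`: `P ∈ Δₙ(m)` and either `m = 0` or `P ∉ Δₙ(m-1)`. -/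
def PolyMinDepth (n : ℕ) (P : Set (Fin n → ℝ)) (m : ℕ) : Prop :=
  P ∈ PolyDepth n m ∧ (m = 0 ∨ P ∉ PolyDepth n (m - 1))

/-- A nonempty face of `P`: either `P` itself or the set of maximizers over `P`
of a linear functional `x ↦ c·x`. -/
def IsFace (n : ℕ) (P F : Set (Fin n → ℝ)) : Prop :=
  F = P ∨ ∃ c : Fin n → ℝ, F = {x ∈ P | ∀ y ∈ P, ∑ i, c i * y i ≤ ∑ i, c i * x i}

/-- `P` is indecomposable: in every decomposition of `P` as a Minkowski sum of polytopes,
each summand is positively homothetic to `P` or a single point. -/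
def Indecomposable (n : ℕ) (P : Set (Fin n → ℝ)) : Prop :=
  ∀ (k : ℕ) (Q : Fin (k + 1) → Set (Fin n → ℝ)),
    (∀ i, IsPolytope n (Q i)) → P = ∑ i, Q i →
    ∀ i, (∃ (lam : ℝ) (w : Fin n → ℝ), 0 < lam ∧ Q i = (fun x => lam • x + w) '' P) ∨
      ∃ a, Q i = {a}

theorem convexHull_mem_polyDepth {n : ℕ} (m : ℕ) (s : Finset (Fin n → ℝ)) (hs : s.Nonempty)
    (hcard : s.card ≤ 2 ^ m) : convexHull ℝ (s : Set (Fin n → ℝ)) ∈ PolyDepth n m := by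
  induction m generalizing s with
  | zero =>
    obtain ⟨a, rfl⟩ := Finset.card_eq_one.1 (le_antisymm hcard hs.card_pos)
    exact ⟨a, by simp⟩
  | succ m ih =>
    obtain ⟨t, r, ht, hr, htcard, hrcard, rfl⟩ : ∃ t r : Finset (Fin n → ℝ),
        t.Nonempty ∧ r.Nonempty ∧ t.card ≤ 2 ^ m ∧ r.card ≤ 2 ^ m ∧ s = t ∪ r := by
      by_cases h : s.card ≤ 2 ^ m
      · exact ⟨s, s, hs, hs, h, h, by simp⟩
      · obtain ⟨t, hts, ht⟩ := Finset.exists_subset_card_eq (le_of_not_ge h)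
        have hsdiff := Finset.card_sdiff_add_card_eq_card hts
        have hpow : 0 < 2 ^ m := by positivity
        rw [pow_succ] at hcard
        refine ⟨t, s \ t, Finset.card_pos.1 (by omega), Finset.card_pos.1 (by omega),
          ht.le, by omega, ?_⟩
        simp [Finset.union_eq_right.2 hts]
    refine ⟨0, fun _ => convexHull ℝ t, fun _ => convexHull ℝ r,
      fun _ => ⟨ih t ht htcard, ih r hr hrcard⟩, ?_⟩
    simp [convexHull_convexHull_union_left, convexHull_convexHull_union_right]

theorem convex_of_mem_polyDepth {n m : ℕ} {P : Set (Fin n → ℝ)} (hP : P ∈ PolyDepth n m) :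
    Convex ℝ P := by
  cases m with
  | zero =>
    obtain ⟨a, rfl⟩ := hP
    exact convex_singleton a
  | succ m =>
    obtain ⟨k, Q, R, -, rfl⟩ := hP
    exact convex_sum _ fun i _ => convex_convexHull ℝ _

section ZeroSumCoords

variable {E ι : Type*} [AddCommGroup E] [Module ℝ E]

/-- The linear map `c` identifies `E` with the hyperplane of vectors whose coordinates sum
to zero. -/
structure IsZeroSumCoords [Fintype ι] (c : E →ₗ[ℝ] ι → ℝ) : Prop where
  injective : Function.Injective c
  sum_eq_zero : ∀ x, ∑ k, c x k = 0
  exists_eq : ∀ q : ι → ℝ, ∑ k, q k = 0 → ∃ x, c x = q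

/-- The face, indexed by `s`, of the homothetic simplex cut out by the inequalities
`p k ≤ c x k`. It is a simplex with vertices indexed by `s` when `∑ k, p k < 0`. -/
def coordFace (c : E →ₗ[ℝ] ι → ℝ) (p : ι → ℝ) (s : Finset ι) : Set E :=
  {x | ∀ k, p k ≤ c x k ∧ (k ∉ s → c x k = p k)}

variable {c : E →ₗ[ℝ] ι → ℝ} {p : ι → ℝ} {s t : Finset ι}

theorem isExtreme_coordFace (hst : s ⊆ t) : IsExtreme ℝ (coordFace c p t) (coordFace c p s) := by
  refine ⟨fun x hx k => ⟨(hx k).1, fun hk => (hx k).2 fun h => hk (hst h)⟩, ?_⟩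
  rintro x hx y hy z hz ⟨a, b, ha, hb, hab, rfl⟩ k
  refine ⟨(hx k).1, fun hk => ?_⟩
  have hz := (hz k).2 hk
  simp only [map_add, map_smul, Pi.add_apply, Pi.smul_apply, smul_eq_mul] at hz
  have hx := (hx k).1
  have hy := (hy k).1
  obtain rfl : b = 1 - a := by linarith
  nlinarith [mul_nonneg hb.le (sub_nonneg.2 hy), mul_nonneg ha.le (sub_nonneg.2 hx)]

theorem convex_coordFace (c : E →ₗ[ℝ] ι → ℝ) (p : ι → ℝ) (s : Finset ι) :
    Convex ℝ (coordFace c p s) := by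
  intro x hx y hy a b ha hb hab k
  have hx := hx k
  have hy := hy k
  obtain rfl : b = 1 - a := by linarith
  simp only [map_add, map_smul, Pi.add_apply, Pi.smul_apply, smul_eq_mul]
  refine ⟨?_, fun hk => ?_⟩
  · nlinarith [mul_nonneg hb (sub_nonneg.2 hy.1), mul_nonneg ha (sub_nonneg.2 hx.1)]
  · rw [hx.2 hk, hy.2 hk]
    ring

/-- The elements of `A` that take part in a decomposition `a + b` of a point of `F`. -/
def summandFace (A B F : Set E) : Set E :=
  {a ∈ A | ∃ b ∈ B, a + b ∈ F}

theorem isExtreme_summandFace {A B F : Set E} (hF : IsExtreme ℝ (A + B) F) :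
    IsExtreme ℝ A (summandFace A B F) := by
  refine ⟨fun a ha => ha.1, ?_⟩
  rintro x hx y hy z ⟨-, b, hb, hzb⟩ hz
  refine ⟨hx, b, hb, hF.left_mem_of_mem_openSegment (Set.add_mem_add hx hb)
    (Set.add_mem_add hy hb) hzb ?_⟩
  simpa only [add_comm _ b] using (mem_openSegment_translate ℝ b).2 hz

theorem convex_summandFace {A B F : Set E} (hA : Convex ℝ A) (hB : Convex ℝ B)
    (hF : Convex ℝ F) : Convex ℝ (summandFace A B F) := by
  rintro x ⟨hx, b, hb, hxb⟩ y ⟨hy, d, hd, hyd⟩ r q hr hq hrq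
  refine ⟨hA hx hy hr hq hrq, r • b + q • d, hB hb hd hr hq hrq, ?_⟩
  convert hF hxb hyd hr hq hrq using 1
  module

theorem add_mem_of_mem_summandFace {A B F : Set E} (hF : IsExtreme ℝ (A + B) F)
    (hconv : Convex ℝ F) {a b : E} (ha : a ∈ summandFace A B F) (hb : b ∈ summandFace B A F) :
    a + b ∈ F := by
  obtain ⟨ha, b', hb', hab'⟩ := ha
  obtain ⟨hb, a', ha', hba'⟩ := hb
  have h2 : (0 : ℝ) < 1 / 2 := by norm_num
  have hmid := hconv hab' hba' h2.le h2.le (by norm_num)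
  refine hF.left_mem_of_mem_openSegment (Set.add_mem_add ha hb) (Set.add_mem_add ha' hb') hmid
    ⟨1 / 2, 1 / 2, h2, h2, by norm_num, ?_⟩
  module

variable [Fintype ι] [DecidableEq ι]

theorem IsZeroSumCoords.exists_vertex (hc : IsZeroSumCoords c) (p : ι → ℝ) (i : ι) :
    ∃ u, c u = p + Pi.single i (-∑ k, p k) :=
  hc.exists_eq _ (by simp [Finset.sum_add_distrib])

theorem vertex_mem_coordFace (hp : ∑ k, p k < 0) {i : ι} (hi : i ∈ s) {u : E}
    (hu : c u = p + Pi.single i (-∑ k, p k)) : u ∈ coordFace c p s := by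
  intro k
  rcases eq_or_ne k i with rfl | hk
  · simp [hu, hi, hp.le]
  · simp [hu, hk]

theorem IsZeroSumCoords.eq_vertex (hc : IsZeroSumCoords c) {i : ι} {u : E}
    (hu : ∀ k ≠ i, c u k = p k) : c u = p + Pi.single i (-∑ k, p k) := by
  have hsum := hc.sum_eq_zero u
  rw [← Finset.add_sum_erase _ _ (Finset.mem_univ i),
    Finset.sum_congr rfl fun k hk => hu k (Finset.ne_of_mem_erase hk)] at hsum
  ext k
  rcases eq_or_ne k i with rfl | hk
  · rw [← Finset.add_sum_erase _ _ (Finset.mem_univ k)]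
    simp only [Pi.add_apply, Pi.single_eq_same]
    linarith
  · simp [hu k hk, hk]

theorem IsZeroSumCoords.coordFace_subset (hc : IsZeroSumCoords c) (hp : ∑ k, p k < 0)
    {K : Set E} (hK : Convex ℝ K)
    (hvert : ∀ i ∈ s, ∀ u, c u = p + Pi.single i (-∑ k, p k) → u ∈ K) :
    coordFace c p s ⊆ K := by
  intro x hx
  choose u hu using hc.exists_vertex p
  set l := -∑ k, p k with hl
  have hl0 : 0 < l := by linarith
  have houtside : ∀ k ∉ s, (c x k - p k) / l = 0 := fun k hk => by simp [(hx k).2 hk]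
  have hsum : ∑ k ∈ s, (c x k - p k) / l = 1 := by
    rw [Finset.sum_subset (Finset.subset_univ s) fun k _ hk => houtside k hk,
      ← Finset.sum_div, Finset.sum_sub_distrib, hc.sum_eq_zero, zero_sub, ← hl, div_self hl0.ne']
  have hcomb : x = ∑ i ∈ s, ((c x i - p i) / l) • u i := by
    apply hc.injective
    ext k
    simp only [map_sum, map_smul, hu, Finset.sum_apply, Pi.smul_apply, Pi.add_apply, smul_eq_mul,
      mul_add, Finset.sum_add_distrib, ← Finset.sum_mul, hsum, one_mul, Pi.single_apply,
      mul_ite, mul_zero, Finset.sum_ite_eq]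
    split_ifs with hk
    · field_simp
      ring
    · rw [(hx k).2 hk, add_zero]
  rw [hcomb]
  exact hK.sum_mem (fun i _ => div_nonneg (sub_nonneg.2 (hx i).1) hl0.le) hsum
    fun i hi => hvert i hi _ (hu i)

theorem IsZeroSumCoords.card_le_one_of_subsingleton (hc : IsZeroSumCoords c)
    (hp : ∑ k, p k < 0) (h : (coordFace c p s).Subsingleton) : s.card ≤ 1 := by
  refine Finset.card_le_one.2 fun i hi j hj => ?_
  obtain ⟨u, hu⟩ := hc.exists_vertex p i
  obtain ⟨v, hv⟩ := hc.exists_vertex p j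
  by_contra hij
  have huv := congrFun (congrArg c
    (h (vertex_mem_coordFace hp hi hu) (vertex_mem_coordFace hp hj hv))) i
  simp [hu, hv, hij, hp.ne] at huv

/-- A simplex that is a face of a Minkowski sum is homothetic to a face of a summand. -/
theorem IsZeroSumCoords.exists_isExtreme_summand (hc : IsZeroSumCoords c) (hs : 1 < s.card)
    (hp : ∑ k, p k < 0) {A B : Set E} (hA : Convex ℝ A) (hB : Convex ℝ B)
    (hF : IsExtreme ℝ (A + B) (coordFace c p s)) :
    ∃ q : ι → ℝ, ∑ k, q k < 0 ∧
      (IsExtreme ℝ A (coordFace c q s) ∨ IsExtreme ℝ B (coordFace c q s)) := by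
  have hconv := convex_coordFace c p s
  have hF' : IsExtreme ℝ (B + A) (coordFace c p s) := by rwa [add_comm]
  have hsum : ∀ a ∈ summandFace A B (coordFace c p s), ∀ b ∈ summandFace B A (coordFace c p s),
      a + b ∈ coordFace c p s :=
    fun a ha b hb => add_mem_of_mem_summandFace hF hconv ha hb
  have hdecomp : ∀ u ∈ coordFace c p s, ∃ a ∈ summandFace A B (coordFace c p s),
      ∃ b ∈ summandFace B A (coordFace c p s), a + b = u := by
    intro u hu
    obtain ⟨a, ha, b, hb, rfl⟩ := hF.subset hu
    exact ⟨a, ⟨ha, b, hb, hu⟩, b, ⟨hb, a, ha, by rwa [add_comm]⟩, rfl⟩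
  have hminimizers : ∀ k, ∃ a ∈ summandFace A B (coordFace c p s),
      ∃ b ∈ summandFace B A (coordFace c p s), c a k + c b k = p k := by
    intro k
    obtain ⟨i, hi, hik⟩ := Finset.exists_mem_ne hs k
    obtain ⟨u, hu⟩ := hc.exists_vertex p i
    obtain ⟨a, ha, b, hb, rfl⟩ := hdecomp u (vertex_mem_coordFace hp hi hu)
    refine ⟨a, ha, b, hb, ?_⟩
    simpa [hik.symm] using congrFun hu k
  choose a ha b hb hab using hminimizers
  have hlowerA : ∀ x ∈ summandFace A B (coordFace c p s), ∀ k, c (a k) k ≤ c x k := by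
    intro x hx k
    have := (hsum x hx _ (hb k) k).1
    rw [map_add, Pi.add_apply] at this
    linarith [hab k]
  have hlowerB : ∀ x ∈ summandFace B A (coordFace c p s), ∀ k, c (b k) k ≤ c x k := by
    intro x hx k
    have := (hsum _ (ha k) x hx k).1
    rw [map_add, Pi.add_apply] at this
    linarith [hab k]
  have hsubA : summandFace A B (coordFace c p s) ⊆ coordFace c (fun k => c (a k) k) s := by
    refine fun x hx k => ⟨hlowerA x hx k, fun hk => ?_⟩
    have := (hsum x hx _ (hb k) k).2 hk
    rw [map_add, Pi.add_apply] at this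
    linarith [hab k]
  have hsubB : summandFace B A (coordFace c p s) ⊆ coordFace c (fun k => c (b k) k) s := by
    refine fun x hx k => ⟨hlowerB x hx k, fun hk => ?_⟩
    have := (hsum _ (ha k) x hx k).2 hk
    rw [map_add, Pi.add_apply] at this
    linarith [hab k]
  have hverts : ∀ i ∈ s,
      (∃ x ∈ summandFace A B (coordFace c p s), ∀ k ≠ i, c x k = c (a k) k) ∧
        ∃ y ∈ summandFace B A (coordFace c p s), ∀ k ≠ i, c y k = c (b k) k := by
    intro i hi
    obtain ⟨u, hu⟩ := hc.exists_vertex p i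
    obtain ⟨x, hx, y, hy, rfl⟩ := hdecomp u (vertex_mem_coordFace hp hi hu)
    have hxy : ∀ k ≠ i, c x k + c y k = p k := fun k hk => by simpa [hk] using congrFun hu k
    exact ⟨⟨x, hx, fun k hk => by linarith [hxy k hk, hab k, hlowerA x hx k, hlowerB y hy k]⟩,
      ⟨y, hy, fun k hk => by linarith [hxy k hk, hab k, hlowerA x hx k, hlowerB y hy k]⟩⟩
  have hsize : ∑ k, c (a k) k + ∑ k, c (b k) k = ∑ k, p k := by
    rw [← Finset.sum_add_distrib]
    exact Finset.sum_congr rfl fun k _ => hab k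
  by_cases hneg : ∑ k, c (a k) k < 0
  · refine ⟨fun k => c (a k) k, hneg, Or.inl ?_⟩
    rw [← hsubA.antisymm (hc.coordFace_subset hneg (convex_summandFace hA hB hconv) ?_)]
    · exact isExtreme_summandFace hF
    · intro i hi u hu
      obtain ⟨x, hx, hxk⟩ := (hverts i hi).1
      rwa [hc.injective (hu.trans (hc.eq_vertex hxk).symm)]
  · have hneg' : ∑ k, c (b k) k < 0 := by linarith
    refine ⟨fun k => c (b k) k, hneg', Or.inr ?_⟩
    rw [← hsubB.antisymm (hc.coordFace_subset hneg' (convex_summandFace hB hA hconv) ?_)]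
    · exact isExtreme_summandFace hF'
    · intro i hi u hu
      obtain ⟨x, hx, hxk⟩ := (hverts i hi).2
      rwa [hc.injective (hu.trans (hc.eq_vertex hxk).symm)]

theorem IsZeroSumCoords.exists_isExtreme_summand_sum (hc : IsZeroSumCoords c) (hs : 1 < s.card)
    {κ : Type*} (I : Finset κ) (T : κ → Set E) (hT : ∀ i, Convex ℝ (T i))
    (hp : ∑ k, p k < 0) (hF : IsExtreme ℝ (∑ i ∈ I, T i) (coordFace c p s)) :
    ∃ i ∈ I, ∃ q : ι → ℝ, ∑ k, q k < 0 ∧ IsExtreme ℝ (T i) (coordFace c q s) := by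
  classical
  induction I using Finset.induction_on generalizing p with
  | empty =>
    rw [Finset.sum_empty] at hF
    exact absurd (hc.card_le_one_of_subsingleton hp
      (Set.subsingleton_singleton.anti hF.subset)) hs.not_ge
  | insert i I hi ih =>
    rw [Finset.sum_insert hi] at hF
    obtain ⟨q, hq, h | h⟩ :=
      hc.exists_isExtreme_summand hs hp (hT i) (convex_sum _ fun j _ => hT j) hF
    · exact ⟨i, Finset.mem_insert_self i I, q, hq, h⟩
    · obtain ⟨j, hj, hq⟩ := ih hq h
      exact ⟨j, Finset.mem_insert_of_mem hj, hq⟩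

/-- The vertices of a simplex face of `conv(Q ∪ R)` split into those of a simplex face of `Q`
and those of a simplex face of `R`. -/
theorem IsZeroSumCoords.exists_cover_of_isExtreme_convexHull_union (hc : IsZeroSumCoords c)
    (hp : ∑ k, p k < 0) {Q R : Set E} (hQ : Convex ℝ Q) (hR : Convex ℝ R)
    (hF : IsExtreme ℝ (convexHull ℝ (Q ∪ R)) (coordFace c p s)) :
    ∃ t r : Finset ι, s ⊆ t ∪ r ∧ IsExtreme ℝ Q (coordFace c p t) ∧
      IsExtreme ℝ R (coordFace c p r) := by
  classical
  choose u hu using hc.exists_vertex p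
  have hmem : ∀ i ∈ s, u i ∈ Q ∪ R := by
    intro i hi
    apply extremePoints_convexHull_subset (𝕜 := ℝ)
    rw [← isExtreme_singleton]
    have hsingle : coordFace c p {i} = {u i} := by
      refine Set.Subset.antisymm (hc.coordFace_subset hp (convex_singleton _) ?_)
        (Set.singleton_subset_iff.2 (vertex_mem_coordFace hp (Finset.mem_singleton_self i) (hu i)))
      intro j hj v hv
      rw [Finset.mem_singleton.1 hj] at hv
      exact hc.injective (hv.trans (hu i).symm)
    rw [← hsingle]
    exact hF.trans (isExtreme_coordFace (Finset.singleton_subset_iff.2 hi))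
  have hpart : ∀ K ⊆ convexHull ℝ (Q ∪ R), Convex ℝ K →
      IsExtreme ℝ K (coordFace c p {i ∈ s | u i ∈ K}) := by
    intro K hKsub hK
    refine (hF.trans (isExtreme_coordFace (Finset.filter_subset _ _))).mono hKsub
      (hc.coordFace_subset hp hK fun i hi v hv => ?_)
    rw [hc.injective (hv.trans (hu i).symm)]
    exact (Finset.mem_filter.1 hi).2
  refine ⟨{i ∈ s | u i ∈ Q}, {i ∈ s | u i ∈ R}, fun i hi => ?_,
    hpart Q (Set.subset_union_left.trans (subset_convexHull ℝ _)) hQ,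
    hpart R (Set.subset_union_right.trans (subset_convexHull ℝ _)) hR⟩
  simpa [hi] using hmem i hi

theorem IsZeroSumCoords.card_le_two_pow {n m : ℕ} {c : (Fin n → ℝ) →ₗ[ℝ] ι → ℝ}
    (hc : IsZeroSumCoords c) (hp : ∑ k, p k < 0) {P : Set (Fin n → ℝ)} (hP : P ∈ PolyDepth n m)
    (hF : IsExtreme ℝ P (coordFace c p s)) : s.card ≤ 2 ^ m := by
  induction m generalizing p s P with
  | zero =>
    obtain ⟨a, rfl⟩ := hP
    exact hc.card_le_one_of_subsingleton hp (Set.subsingleton_singleton.anti hF.subset)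
  | succ m ih =>
    obtain ⟨k, Q, R, hQR, rfl⟩ := hP
    rcases le_or_gt s.card 1 with hs | hs
    · exact hs.trans Nat.one_le_two_pow
    · obtain ⟨i, -, q, hq, hi⟩ := hc.exists_isExtreme_summand_sum hs Finset.univ _
        (fun i => convex_convexHull ℝ _) hp hF
      obtain ⟨t, r, hst, ht, hr⟩ := hc.exists_cover_of_isExtreme_convexHull_union hq
        (convex_of_mem_polyDepth (hQR i).1) (convex_of_mem_polyDepth (hQR i).2) hi
      calc s.card ≤ (t ∪ r).card := Finset.card_le_card hst
        _ ≤ t.card + r.card := Finset.card_union_le t r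
        _ ≤ 2 ^ m + 2 ^ m := add_le_add (ih hq (hQR i).1 ht) (ih hq (hQR i).2 hr)
        _ = 2 ^ (m + 1) := by ring

theorem AffineBasis.isZeroSumCoords (b : AffineBasis ι ℝ E) :
    IsZeroSumCoords (LinearMap.pi fun k => (b.coord k).linear) := by
  have hlin : ∀ k x, (b.coord k).linear x = b.coord k x - b.coord k 0 := fun k x => by
    simpa using (b.coord k).linearMap_vsub x 0
  refine ⟨fun x y hxy => b.ext_elem fun k => ?_, fun x => ?_, fun q hq => ?_⟩
  · have := congrFun hxy k
    simp only [LinearMap.pi_apply, hlin] at this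
    linarith
  · simp only [LinearMap.pi_apply, hlin, Finset.sum_sub_distrib, b.sum_coord_apply_eq_one,
      sub_self]
  · refine ⟨∑ k, q k • b k, ?_⟩
    ext j
    rw [LinearMap.pi_apply, map_sum]
    simp only [map_smul]
    simp [hlin, b.coord_apply, mul_sub, Finset.sum_sub_distrib, ← Finset.sum_mul, hq,
      -AffineBasis.linear_eq_sumCoords]

end ZeroSumCoords

/-- Any `n`-simplex, the convex hull of `n + 1` affinely independent points,
has minimal depth `⌈log₂ (n + 1)⌉`. -/
theorem statement18 (n : ℕ) (x : Fin (n + 1) → Fin n → ℝ)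
    (hx : AffineIndependent ℝ x) :
    PolyMinDepth n (convexHull ℝ (Set.range x)) (Nat.clog 2 (n + 1)) := by
  refine ⟨?_, ?_⟩
  · have hmem := convexHull_mem_polyDepth (Nat.clog 2 (n + 1)) (Finset.univ.image x)
      (Finset.univ_nonempty.image x)
      ((Finset.card_image_le.trans_eq (by simp)).trans (Nat.le_pow_clog one_lt_two (n + 1)))
    simpa using hmem
  · rcases Nat.eq_zero_or_pos n with rfl | hn
    · simp
    refine Or.inr fun hP => ?_
    let b : AffineBasis (Fin (n + 1)) ℝ (Fin n → ℝ) :=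
      ⟨x, hx, hx.affineSpan_eq_top_iff_card_eq_finrank_add_one.2 (by simp)⟩
    have hface : convexHull ℝ (Set.range x) = coordFace
        (LinearMap.pi fun k => (b.coord k).linear) (fun k => -b.coord k 0) Finset.univ := by
      refine b.convexHull_eq_nonneg_coord.trans (Set.ext fun y => forall_congr' fun k => ?_)
      have hlin : (b.coord k).linear y = b.coord k y - b.coord k 0 := by
        simpa using (b.coord k).linearMap_vsub y 0
      simp [hlin, -AffineBasis.linear_eq_sumCoords]
    have hcard := b.isZeroSumCoords.card_le_two_pow (p := fun k => -b.coord k 0)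
      (s := Finset.univ) (by simp) hP (by rw [hface])
    rw [Finset.card_univ, Fintype.card_fin] at hcard
    exact (Nat.pow_pred_clog_lt_self one_lt_two (by omega : 1 < n + 1)).not_ge hcard
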